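/- arXiv:1304.6889 — 3 statements merged into one kernel-verified Lean document; each statement's English description precedes it below -/
import Mathlib

section
/- Let A be a commutative ring, 𝔞 ⊆ A[x₁,…,xₙ] a nonzero ideal, and suppose 𝔞 has a Gröbner basis G with respect to a monomial order ≺ such that every element of G is monic. Then the quotient A[x₁,…,xₙ]/𝔞 is a free A-module. -/
open MvPolynomial

namespace GB

variable {σ A : Type*} [CommRing A]

/-- Leading monomial (exponent vector) of `f` w.r.t. the monomial order `m`. -/
noncomputable def lm (m : MonomialOrder σ) (f : MvPolynomial σ A) : σ →₀ ℕ :=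
  m.toSyn.symm (f.support.sup fun α => m.toSyn α)

/-- Leading coefficient of `f` w.r.t. `m`. -/
noncomputable def lc (m : MonomialOrder σ) (f : MvPolynomial σ A) : A :=
  f.coeff (lm m f)

/-- Leading term of `f` w.r.t. `m`. -/
noncomputable def lt (m : MonomialOrder σ) (f : MvPolynomial σ A) : MvPolynomial σ A :=
  monomial (lm m f) (lc m f)

/-- `G` is a Gröbner basis of the ideal `I` w.r.t. the monomial order `m`:
`G ⊆ I` and `⟨lt f : f ∈ I, f ≠ 0⟩ = ⟨lt g : g ∈ G⟩`. -/
def IsGrobnerBasis (m : MonomialOrder σ) (I : Ideal (MvPolynomial σ A))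
    (G : Finset (MvPolynomial σ A)) : Prop :=
  (G : Set (MvPolynomial σ A)) ⊆ I ∧
    Ideal.span (lt m '' {f : MvPolynomial σ A | f ∈ I ∧ f ≠ 0}) =
      Ideal.span (lt m '' (G : Set (MvPolynomial σ A)))

/-- `G` is monic: every element has leading coefficient `1`. -/
def IsMonic (m : MonomialOrder σ) (G : Finset (MvPolynomial σ A)) : Prop :=
  ∀ g ∈ G, lc m g = 1

/-- The border of an order ideal `O` of monomials:
`∂O = (x₁·O ∪ ⋯ ∪ xₙ·O) \ O`. -/
def border {n : ℕ} (O : Set (Fin n →₀ ℕ)) : Set (Fin n →₀ ℕ) :=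
  (⋃ i : Fin n, (fun α => α + Finsupp.single i 1) '' O) \ O

end GB

/-- The polynomials none of whose monomials is divisible by the leading monomial of an element
of `G` map isomorphically onto the quotient by an ideal with monic Gröbner basis `G`. -/
theorem GB.IsGrobnerBasis.bijective_mkQ_restrictSupport {σ A : Type*} [CommRing A]
    {m : MonomialOrder σ} {I : Ideal (MvPolynomial σ A)} {G : Finset (MvPolynomial σ A)}
    (hG : GB.IsGrobnerBasis m I G) (hmonic : GB.IsMonic m G) :
    Function.Bijective ((Ideal.Quotient.mkₐ A I).toLinearMap.comp
      (restrictSupport A {c | ∀ g ∈ G, ¬ m.degree g ≤ c}).subtype) := by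
  constructor
  · rw [injective_iff_map_eq_zero]
    rintro ⟨f, hf⟩ hfI
    replace hfI : f ∈ I := Ideal.Quotient.eq_zero_iff_mem.mp hfI
    by_contra hne
    have hf0 : f ≠ 0 := fun h => hne (Subtype.ext h)
    have hlt : GB.lt m f ∈ Ideal.span (GB.lt m '' (G : Set (MvPolynomial σ A))) :=
      hG.2 ▸ Ideal.subset_span ⟨f, ⟨hfI, hf0⟩, rfl⟩
    have himage : GB.lt m '' (G : Set (MvPolynomial σ A)) =
        (fun s => monomial s (1 : A)) '' (m.degree '' (G : Set (MvPolynomial σ A))) := by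
      rw [Set.image_image]
      refine Set.image_congr fun g hg => ?_
      rw [GB.lt, hmonic g hg]
      rfl
    rw [himage, mem_ideal_span_monomial_image] at hlt
    have hmem : m.degree f ∈ (GB.lt m f).support := by
      change m.degree f ∈ (m.leadingTerm f).support
      rw [m.support_leadingTerm' hf0]
      exact Finset.mem_singleton_self _
    obtain ⟨_, ⟨g, hg, rfl⟩, hle⟩ := hlt _ hmem
    exact hf (m.degree_mem_support hf0) g hg hle
  · intro q
    obtain ⟨f, rfl⟩ := Ideal.Quotient.mk_surjective q
    obtain ⟨c, r, hfr, -, hr⟩ := m.div_set (B := (G : Set (MvPolynomial σ A)))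
      (fun g hg => (show m.leadingCoeff g = 1 from hmonic g hg) ▸ isUnit_one) f
    refine ⟨⟨r, hr⟩, ?_⟩
    refine (Ideal.Quotient.eq.mpr ?_).symm
    change f - r ∈ I
    rw [hfr, add_sub_cancel_right, Finsupp.linearCombination_apply]
    exact Submodule.sum_mem _ fun g _ => I.smul_mem _ (hG.1 g.2)


/-- If a nonzero ideal of `A[x₁,…,xₙ]` has a monic Gröbner basis, the quotient is a
free `A`-module. -/
theorem monic_groebnerBasis_quotient_free
    {n : ℕ} {A : Type*} [CommRing A] (m : MonomialOrder (Fin n))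
    (𝔞 : Ideal (MvPolynomial (Fin n) A)) (h𝔞 : 𝔞 ≠ ⊥)
    (G : Finset (MvPolynomial (Fin n) A))
    (hG : GB.IsGrobnerBasis m 𝔞 G) (hmonic : GB.IsMonic m G) :
    Module.Free A (MvPolynomial (Fin n) A ⧸ 𝔞) := by
  exact (Module.Free.of_basis (basisRestrictSupport A _)).of_equiv
    (LinearEquiv.ofBijective _ (hG.bijective_mkQ_restrictSupport hmonic))
end

section
/- Let A be a commutative ring, 𝔞 ⊆ A[x₁,…,xₙ] a nonzero ideal, and G a monic Gröbner basis of 𝔞 with respect to a monomial order ≺. Then the family of residue classes {x^α + 𝔞 : x^α is a standard monomial w.r.t. G}, indexed by the standard monomials, is A-linearly independent in A[x₁,…,xₙ]/𝔞. -/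
open MvPolynomial

namespace GB

/-- A nonzero element of an ideal has leading monomial divisible by the leading monomial of some
element of any monic Gröbner basis of that ideal. -/
theorem IsGrobnerBasis.exists_lm_le {σ A : Type*} [CommRing A] {m : MonomialOrder σ}
    {I : Ideal (MvPolynomial σ A)} {G : Finset (MvPolynomial σ A)} (hG : IsGrobnerBasis m I G)
    (hmonic : IsMonic m G) {f : MvPolynomial σ A} (hf : f ∈ I) (hf0 : f ≠ 0) :
    ∃ g ∈ G, lm m g ≤ lm m f := by
  classical
  have hlt : lt m f ∈ Ideal.span (lt m '' (G : Set (MvPolynomial σ A))) :=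
    hG.2 ▸ Ideal.subset_span ⟨f, ⟨hf, hf0⟩, rfl⟩
  have himage : lt m '' (G : Set (MvPolynomial σ A)) =
      (fun α => monomial α (1 : A)) '' (lm m '' (G : Set (MvPolynomial σ A))) := by
    rw [Set.image_image]
    exact Set.image_congr fun g hg => by rw [lt, hmonic g hg]
  rw [himage, mem_ideal_span_monomial_image] at hlt
  have hlc : lc m f ≠ 0 := m.leadingCoeff_ne_zero_iff.mpr hf0
  obtain ⟨_, ⟨g, hg, rfl⟩, hle⟩ := hlt (lm m f) (by simpa [lt] using hlc)
  exact ⟨g, hg, hle⟩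

end GB

/-- The residue classes of the standard monomials w.r.t. a monic Gröbner basis are
`A`-linearly independent in the quotient. -/
theorem standard_monomials_linearIndependent
    {n : ℕ} {A : Type*} [CommRing A] (m : MonomialOrder (Fin n))
    (𝔞 : Ideal (MvPolynomial (Fin n) A)) (h𝔞 : 𝔞 ≠ ⊥)
    (G : Finset (MvPolynomial (Fin n) A))
    (hG : GB.IsGrobnerBasis m 𝔞 G) (hmonic : GB.IsMonic m G) :
    LinearIndependent A
      (fun α : {α : Fin n →₀ ℕ // ∀ g ∈ G, ¬ GB.lm m g ≤ α} =>
        Ideal.Quotient.mk 𝔞 (monomial (α : Fin n →₀ ℕ) (1 : A))) := by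
  classical
  rw [linearIndependent_iff]
  intro l hl
  set f : MvPolynomial (Fin n) A :=
    Finsupp.linearCombination A (fun α : {α : Fin n →₀ ℕ // ∀ g ∈ G, ¬ GB.lm m g ≤ α} =>
      monomial (α : Fin n →₀ ℕ) (1 : A)) l with hf
  have hcoeff : ∀ β, f.coeff β = l.sum fun α a => if (α : Fin n →₀ ℕ) = β then a else 0 := by
    intro β
    simp [hf, Finsupp.linearCombination_apply, Finsupp.sum, coeff_sum, coeff_monomial]
  have hmem : f ∈ 𝔞 := by
    rw [← Ideal.Quotient.eq_zero_iff_mem, ← hl, hf]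
    exact Finsupp.apply_linearCombination A (Ideal.Quotient.mkₐ A 𝔞).toLinearMap _ l
  have hzero : f = 0 := by
    by_contra hne
    obtain ⟨g, hg, hle⟩ := hG.exists_lm_le hmonic hmem hne
    refine m.leadingCoeff_ne_zero_iff.mpr hne ((hcoeff (GB.lm m f)).trans ?_)
    refine Finset.sum_eq_zero fun α _ => if_neg fun h => α.2 g hg ?_
    rwa [h]
  ext β
  have h := hcoeff β
  rw [hzero] at h
  simpa [Finsupp.sum, Subtype.coe_inj, eq_comm] using h
end

section
/- Let L ⊆ ℤⁿ be a subgroup (a lattice) and let 𝔞_L ⊆ ℤ[x₁,…,xₙ] be the lattice ideal of L, i.e., the ideal generated by the binomials x^{v⁺} − x^{v⁻} for v ∈ L, where v⁺, v⁻ ∈ ℕⁿ are the coordinatewise positive and negative parts of v (so v = v⁺ − v⁻). Then the quotient ring ℤ[x₁,…,xₙ]/𝔞_L is a free ℤ-module. -/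
open MvPolynomial

/-- The coordinatewise positive part of `v ∈ ℤⁿ`, as an exponent vector. -/
noncomputable def posPart {n : ℕ} (v : Fin n → ℤ) : Fin n →₀ ℕ :=
  Finsupp.equivFunOnFinite.symm fun i => (v i).toNat

/-- The coordinatewise negative part of `v ∈ ℤⁿ`, as an exponent vector. -/
noncomputable def negPart {n : ℕ} (v : Fin n → ℤ) : Fin n →₀ ℕ :=
  Finsupp.equivFunOnFinite.symm fun i => (-(v i)).toNat

/-- The congruence on exponent vectors identifying those whose difference lies in `L`. -/
noncomputable def latticeCon {n : ℕ} (L : AddSubgroup (Fin n → ℤ)) : AddCon (Fin n →₀ ℕ) :=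
  AddCon.ker ((QuotientAddGroup.mk' L).comp
    ((AddMonoidHom.pi fun i => (Nat.castAddMonoidHom ℤ).comp (Finsupp.applyAddHom i)) :
      (Fin n →₀ ℕ) →+ (Fin n → ℤ)))

theorem latticeCon_iff {n : ℕ} (L : AddSubgroup (Fin n → ℤ)) (α β : Fin n →₀ ℕ) :
    latticeCon L α β ↔ (fun i => (β i : ℤ) - α i) ∈ L := by
  rw [latticeCon, AddCon.ker_rel]
  simp only [AddMonoidHom.comp_apply, QuotientAddGroup.mk'_apply]
  rw [QuotientAddGroup.eq]
  refine iff_of_eq (congrArg (· ∈ L) ?_)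
  ext i
  simp [neg_add_eq_sub, AddMonoidHom.pi]

theorem latticeCon_posPart_negPart {n : ℕ} {L : AddSubgroup (Fin n → ℤ)} {v : Fin n → ℤ}
    (hv : v ∈ L) : latticeCon L (posPart v) (negPart v) := by
  rw [latticeCon_iff]
  convert L.neg_mem hv using 1
  ext i
  simp only [_root_.posPart, _root_.negPart, Finsupp.coe_equivFunOnFinite_symm, Pi.neg_apply]
  omega

/-- A quotient of a polynomial ring that identifies monomials exactly along a congruence of
exponent vectors is free over the coefficient ring. -/
theorem MvPolynomial.free_quotient_of_addCon {σ R : Type*} [CommRing R] (c : AddCon (σ →₀ ℕ))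
    (I : Ideal (MvPolynomial σ R))
    (hI : ∀ p ∈ I, AddMonoidAlgebra.mapDomainRingHom R c.mk' p = 0)
    (hc : ∀ α β, c α β → monomial α (1 : R) - monomial β 1 ∈ I) :
    Module.Free R (MvPolynomial σ R ⧸ I) := by
  let b : c.Quotient → MvPolynomial σ R ⧸ I := fun q =>
    Ideal.Quotient.mk I (monomial (Quotient.out q) 1)
  have hb (α : σ →₀ ℕ) : Ideal.Quotient.mk I (monomial α 1) = b (c.mk' α) := by
    refine Ideal.Quotient.eq.mpr (hc _ _ ?_)
    exact c.symm (Quotient.mk_out (s := c.toSetoid) α)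
  let f := Ideal.Quotient.lift I (AddMonoidAlgebra.mapDomainRingHom R c.mk') hI
  have hfb (r : R) (q : c.Quotient) : f (r • b q) = .single q r := by
    have : r • b q = Ideal.Quotient.mk I (monomial (Quotient.out q) r) := by
      rw [← Ideal.Quotient.mkₐ_eq_mk R, ← mul_one r, ← smul_eq_mul, ← smul_monomial, map_smul]
      simp [b]
    rw [this, Ideal.Quotient.lift_mk, ← single_eq_monomial]
    refine (AddMonoidAlgebra.mapDomain_single).trans ?_
    congr 1
    exact Quotient.out_eq q
  have hf (l : c.Quotient →₀ R) :
      f (Finsupp.linearCombination R b l) = AddMonoidAlgebra.ofCoeff l := by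
    induction l using Finsupp.induction_linear with
    | zero => simp
    | add x y hx hy => rw [map_add, map_add, hx, hy, AddMonoidAlgebra.ofCoeff_add]
    | single q r => rw [Finsupp.linearCombination_single]; exact hfb r q
  have hli : LinearIndependent R b := by
    rw [linearIndependent_iff]
    intro l hl
    have key := hf l
    rw [hl, map_zero] at key
    exact (congrArg AddMonoidAlgebra.coeff key).symm
  refine Module.Free.of_basis (Module.Basis.mk hli ?_)
  rintro x -
  obtain ⟨p, rfl⟩ := Ideal.Quotient.mk_surjective x
  induction p using MvPolynomial.induction_on' with
  | monomial α r =>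
    rw [← mul_one r, ← smul_eq_mul, ← smul_monomial, ← Ideal.Quotient.mkₐ_eq_mk R, map_smul,
      Ideal.Quotient.mkₐ_eq_mk, hb]
    exact Submodule.smul_mem _ _ (Submodule.subset_span ⟨_, rfl⟩)
  | add p q hp hq => rw [map_add]; exact Submodule.add_mem _ hp hq

/-- The quotient of `ℤ[x₁,…,xₙ]` by a lattice ideal is a free `ℤ`-module. -/
theorem latticeIdeal_quotient_free {n : ℕ} (L : AddSubgroup (Fin n → ℤ)) :
    Module.Free ℤ (MvPolynomial (Fin n) ℤ ⧸
      Ideal.span {p : MvPolynomial (Fin n) ℤ |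
        ∃ v ∈ L, p = monomial (posPart v) (1 : ℤ) - monomial (negPart v) (1 : ℤ)}) := by
  refine MvPolynomial.free_quotient_of_addCon (latticeCon L) _ (fun p hp => ?_) fun α β h => ?_
  · rw [← RingHom.mem_ker]
    refine Ideal.span_le.mpr ?_ hp
    rintro _ ⟨v, hv, rfl⟩
    rw [SetLike.mem_coe, RingHom.mem_ker, map_sub, sub_eq_zero, ← single_eq_monomial,
      ← single_eq_monomial]
    refine AddMonoidAlgebra.mapDomain_single.trans (.trans ?_ AddMonoidAlgebra.mapDomain_single.symm)
    congr 1
    exact (latticeCon L).eq.mpr (latticeCon_posPart_negPart hv)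
  · have hv := (latticeCon_iff L β α).mp ((latticeCon L).symm h)
    have hα : α = α ⊓ β + _root_.posPart fun i => (α i : ℤ) - β i := by
      ext i
      simp [_root_.posPart]
      omega
    have hβ : β = α ⊓ β + _root_.negPart fun i => (α i : ℤ) - β i := by
      ext i
      simp [_root_.negPart]
      omega
    have : monomial α (1 : ℤ) - monomial β 1 = monomial (α ⊓ β) 1 *
        (monomial (_root_.posPart fun i => (α i : ℤ) - β i) 1 -
          monomial (_root_.negPart fun i => (α i : ℤ) - β i) 1) := by
      rw [mul_sub, monomial_mul, monomial_mul, ← hα, ← hβ, mul_one]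
    rw [this]
    exact Ideal.mul_mem_left _ _ (Ideal.subset_span ⟨_, hv, rfl⟩)
end
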